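/- Let k ≥ 2 and n ≥ k+2. Let v and v' be vertices of S_{n,k}; let u_1,…,u_{n−k} and u'_1,…,u'_{n−k} be enumerations of the residual-adjacent neighbors of v and of v' respectively, and let w_1,…,w_{k−1} and w'_1,…,w'_{k−1} be enumerations of the star-adjacent neighbors of v and of v' respectively. Then there is a unique graph automorphism f of S_{n,k} with f(v) = v', f(u_i) = u'_i for all 1 ≤ i ≤ n−k, and f(w_j) = w'_j for all 1 ≤ j ≤ k−1. -/

import Mathlib

open Equiv

/-- Vertices of the `(n,k)`-star graph: `k`-permutations of an `n`-set, i.e.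
ordered `k`-tuples of distinct elements (positions and values are `0`-indexed,
so "position 1" of the paper is the index `j : Fin k` with `j.1 = 0`). -/
def StarVertex (n k : ℕ) : Type :=
  {a : Fin k → Fin n // Function.Injective a}

/-- `u` and `v` are joined by a residual edge: they differ exactly in position 1. -/
def IsResEdge {n k : ℕ} (u v : StarVertex n k) : Prop :=
  (∀ j : Fin k, j.1 = 0 → u.1 j ≠ v.1 j) ∧ ∀ j : Fin k, j.1 ≠ 0 → u.1 j = v.1 j

/-- `u` and `v` are joined by a star edge: `v` is obtained from `u` by exchanging
the entries in position 1 and position `i` for some position `i ≠ 1`. -/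
def IsStarEdge {n k : ℕ} (u v : StarVertex n k) : Prop :=
  ∃ i : Fin k, i.1 ≠ 0 ∧
    (∀ j : Fin k, j.1 = 0 → v.1 j = u.1 i ∧ v.1 i = u.1 j) ∧
    ∀ j : Fin k, j.1 ≠ 0 → j ≠ i → v.1 j = u.1 j

/-- The `(n,k)`-star graph `S_{n,k}`. -/
def starGraph (n k : ℕ) : SimpleGraph (StarVertex n k) :=
  SimpleGraph.fromRel fun u v => IsStarEdge u v ∨ IsResEdge u v

/-- A (finite) graph is a Cayley graph if it is isomorphic to the Cayley graph of some
finite group `G` with connection set `S ⊆ G` satisfying `1 ∉ S` and `S = S⁻¹`. -/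
def IsCayleyGraph {V : Type*} (Γ : SimpleGraph V) : Prop :=
  ∃ (G : Type) (_ : Group G) (_ : Fintype G) (S : Set G),
    (1 : G) ∉ S ∧ (∀ s ∈ S, s⁻¹ ∈ S) ∧
    Nonempty (Γ ≃g SimpleGraph.fromRel fun g h : G => g⁻¹ * h ∈ S)

/-- The automorphism group of a graph, as a subgroup of the permutation group
of the vertex set. -/
def graphAut {V : Type*} (Γ : SimpleGraph V) : Subgroup (Equiv.Perm V) where
  carrier := {σ | ∀ u w : V, Γ.Adj (σ u) (σ w) ↔ Γ.Adj u w}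
  one_mem' := by intro u w; simp
  mul_mem' := by
    intro a b ha hb u w
    rw [Equiv.Perm.mul_apply, Equiv.Perm.mul_apply, ha, hb]
  inv_mem' := by
    intro a ha u w
    simpa using (ha (a⁻¹ u) (a⁻¹ w)).symm

/-- The copy of `S_{k-1}` inside the symmetric group on the `k` positions:
permutations of the positions `2,…,k` fixing position `1`. (Via the further
identification of positions `2,…,k` with the corresponding points, this is the
subgroup `S_{k-1} ≤ S_n` of the paper.) -/
def SkSub (k : ℕ) : Subgroup (Equiv.Perm (Fin k)) where
  carrier := {ν | ∀ j : Fin k, j.1 = 0 → ν j = j}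
  one_mem' := by intro j hj; simp
  mul_mem' := by
    intro a b ha hb j hj
    rw [Equiv.Perm.mul_apply, hb j hj, ha j hj]
  inv_mem' := by
    intro a ha j hj
    have h : a⁻¹ (a j) = j := by simp
    rwa [ha j hj] at h

/-- The vertex `ē = [1,2,…,k]` of `S_{n,k}`. -/
def eVert (n k : ℕ) (h : k ≤ n) : StarVertex n k :=
  ⟨fun j => ⟨j.1, lt_of_lt_of_le j.2 h⟩, fun a b hab => Fin.ext (by simpa using congrArg Fin.val hab)⟩

/-- The action `φ(μ,ν)` on vertices: `[a_1,…,a_k] ↦ [μ(a_{ν⁻¹(1)}),…,μ(a_{ν⁻¹(k)})]`. -/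
def phi (n k : ℕ) (μ : Equiv.Perm (Fin n)) (ν : Equiv.Perm (Fin k))
    (a : StarVertex n k) : StarVertex n k :=
  ⟨fun j => μ (a.1 (ν⁻¹ j)), fun x y hxy =>
    (Equiv.injective ν⁻¹) (a.2 (Equiv.injective μ hxy))⟩

/-- `φ(μ,ν)` as a permutation of the vertices of `S_{n,k}`. -/
def phiPerm (n k : ℕ) (μ : Equiv.Perm (Fin n)) (ν : Equiv.Perm (Fin k)) :
    Equiv.Perm (StarVertex n k) where
  toFun := phi n k μ ν
  invFun := phi n k μ⁻¹ ν⁻¹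
  left_inv a := Subtype.ext (funext fun j => by simp [phi])
  right_inv a := Subtype.ext (funext fun j => by simp [phi])

/-- A subgroup `H ≤ S_n` is `m`-transitive: it acts transitively on the set of
`m`-permutations (injective `m`-tuples). -/
def IsMultTrans (n m : ℕ) (H : Subgroup (Equiv.Perm (Fin n))) : Prop :=
  ∀ a b : Fin m → Fin n, Function.Injective a → Function.Injective b →
    ∃ μ ∈ H, ∀ j, μ (a j) = b j

/-- A subgroup `H ≤ S_n` is sharply `m`-transitive: it acts regularly on the set of
`m`-permutations (injective `m`-tuples). -/
def IsSharplyMultTrans (n m : ℕ) (H : Subgroup (Equiv.Perm (Fin n))) : Prop :=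
  ∀ a b : Fin m → Fin n, Function.Injective a → Function.Injective b →
    ∃! μ : H, ∀ j, (μ : Equiv.Perm (Fin n)) (a j) = b j

section StarGraph

theorem StarVertex.ext {n k : ℕ} {u v : StarVertex n k} (h : ∀ j, u.1 j = v.1 j) : u = v :=
  Subtype.ext (funext h)

variable {n k : ℕ} [NeZero k]

/-- Exchange the entries in the first position and in position `i`. -/
def swapHead (i : Fin k) (u : StarVertex n k) : StarVertex n k :=
  ⟨fun j => u.1 (swap 0 i j), fun _ _ h => (swap 0 i).injective (u.2 h)⟩

@[simp] theorem swapHead_apply_zero (i : Fin k) (u : StarVertex n k) :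
    (swapHead i u).1 0 = u.1 i := by simp [swapHead]

@[simp] theorem swapHead_apply_self (i : Fin k) (u : StarVertex n k) :
    (swapHead i u).1 i = u.1 0 := by simp [swapHead]

theorem swapHead_apply_of_ne {i j : Fin k} (u : StarVertex n k) (h0 : j ≠ 0) (hi : j ≠ i) :
    (swapHead i u).1 j = u.1 j := by
  simp [swapHead, swap_apply_of_ne_of_ne h0 hi]

theorem swapHead_apply (i j : Fin k) (u : StarVertex n k) :
    (swapHead i u).1 j = if j = 0 then u.1 i else if j = i then u.1 0 else u.1 j := by
  by_cases h0 : j = 0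
  · subst h0; simp
  · by_cases hi : j = i
    · subst hi; simp [h0]
    · simp [h0, hi, swapHead_apply_of_ne]

@[simp] theorem swapHead_swapHead (i : Fin k) (u : StarVertex n k) :
    swapHead i (swapHead i u) = u :=
  StarVertex.ext fun j => by simp [swapHead]

theorem swapHead_left_injective (u : StarVertex n k) :
    Function.Injective fun i => swapHead i u := by
  intro i j h
  have := congrArg (fun x : StarVertex n k => x.1 0) h
  exact u.2 (by simpa using this)

theorem isStarEdge_iff {u v : StarVertex n k} :
    IsStarEdge u v ↔ ∃ i, i ≠ 0 ∧ v = swapHead i u := by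
  constructor
  · rintro ⟨i, hi, h1, h2⟩
    have hi0 : i ≠ 0 := fun h => hi (by simp [h])
    refine ⟨i, hi0, StarVertex.ext fun j => ?_⟩
    have h := h1 0 (by simp)
    rw [swapHead_apply]
    split_ifs with hj hji
    · rw [hj, h.1]
    · rw [hji, h.2]
    · exact h2 j (fun h => hj (Fin.ext (by simpa using h))) hji
  · rintro ⟨i, hi, rfl⟩
    refine ⟨i, fun h => hi (Fin.ext (by simpa using h)), fun j hj => ?_, fun j hj hji => ?_⟩
    · obtain rfl : j = 0 := Fin.ext (by simpa using hj)
      simp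
    · exact swapHead_apply_of_ne u (fun h => hj (by simp [h])) hji

theorem isResEdge_iff {u v : StarVertex n k} :
    IsResEdge u v ↔ u.1 0 ≠ v.1 0 ∧ ∀ j, j ≠ 0 → u.1 j = v.1 j := by
  constructor
  · rintro ⟨h1, h2⟩
    exact ⟨h1 0 (by simp), fun j hj => h2 j fun h => hj (Fin.ext (by simpa using h))⟩
  · rintro ⟨h1, h2⟩
    refine ⟨fun j hj => ?_, fun j hj => h2 j fun h => hj (by simp [h])⟩
    obtain rfl : j = 0 := Fin.ext (by simpa using hj)
    exact h1

theorem IsStarEdge.symm {u v : StarVertex n k} (h : IsStarEdge u v) : IsStarEdge v u := by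
  obtain ⟨i, hi, rfl⟩ := isStarEdge_iff.1 h
  exact isStarEdge_iff.2 ⟨i, hi, by simp⟩

theorem IsResEdge.symm {u v : StarVertex n k} (h : IsResEdge u v) : IsResEdge v u := by
  rw [isResEdge_iff] at *
  exact ⟨h.1.symm, fun j hj => (h.2 j hj).symm⟩

theorem IsResEdge.ne {u v : StarVertex n k} (h : IsResEdge u v) : u ≠ v := by
  rintro rfl
  exact (isResEdge_iff.1 h).1 rfl

theorem swapHead_ne {i : Fin k} (hi : i ≠ 0) (u : StarVertex n k) : swapHead i u ≠ u := by
  intro h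
  have := congrArg (fun x : StarVertex n k => x.1 0) h
  exact hi (u.2 (by simpa using this))

theorem starGraph_adj {u v : StarVertex n k} :
    (starGraph n k).Adj u v ↔ IsStarEdge u v ∨ IsResEdge u v := by
  rw [starGraph, SimpleGraph.fromRel_adj]
  constructor
  · rintro ⟨-, h | h⟩
    · exact h
    · exact h.imp IsStarEdge.symm IsResEdge.symm
  · intro h
    refine ⟨?_, Or.inl h⟩
    rcases h with h | h
    · obtain ⟨i, hi, rfl⟩ := isStarEdge_iff.1 h
      exact (swapHead_ne hi u).symm
    · exact h.ne

/-- A neighbour that changes the entry in position `i ≠ 0` exchanges it with the first one. -/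
theorem eq_swapHead_of_adj {u t : StarVertex n k} (h : (starGraph n k).Adj u t) {i : Fin k}
    (hi : i ≠ 0) (ht : t.1 i ≠ u.1 i) : t = swapHead i u := by
  rcases starGraph_adj.1 h with h | h
  · obtain ⟨j, hj, rfl⟩ := isStarEdge_iff.1 h
    by_cases hij : i = j
    · rw [hij]
    · exact absurd (swapHead_apply_of_ne u hi hij) ht
  · exact absurd ((isResEdge_iff.1 h).2 i hi).symm ht

theorem exists_isResEdge {u : StarVertex n k} {x : Fin n} (hx : ∀ j, u.1 j ≠ x) :
    ∃ t, IsResEdge u t ∧ t.1 0 = x := by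
  refine ⟨⟨Function.update u.1 0 x, ?_⟩, isResEdge_iff.2 ⟨?_, ?_⟩, ?_⟩
  · intro a b hab
    have := @u.2 a b
    have := hx a
    have := hx b
    simp only [Function.update_apply] at hab
    grind
  · simpa using hx 0
  · intro j hj
    simp [hj]
  · simp

theorem IsResEdge.apply_ne {u t : StarVertex n k} (h : IsResEdge u t) (j : Fin k) :
    u.1 j ≠ t.1 0 := by
  rw [isResEdge_iff] at h
  by_cases hj : j = 0
  · rw [hj]; exact h.1
  · rw [h.2 j hj]
    exact fun h => hj (t.2 h)

theorem IsResEdge.eq_of_apply_zero {u s t : StarVertex n k} (hs : IsResEdge u s)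
    (ht : IsResEdge u t) (h : s.1 0 = t.1 0) : s = t := by
  rw [isResEdge_iff] at *
  refine StarVertex.ext fun j => ?_
  by_cases hj : j = 0
  · rw [hj, h]
  · rw [← hs.2 j hj, ht.2 j hj]

theorem IsResEdge.trans_of_ne {u s t : StarVertex n k} (hs : IsResEdge u s)
    (ht : IsResEdge u t) (h : s ≠ t) : IsResEdge s t := by
  refine isResEdge_iff.2 ⟨fun h0 => h (hs.eq_of_apply_zero ht h0), fun j hj => ?_⟩
  rw [isResEdge_iff] at *
  rw [← hs.2 j hj, ht.2 j hj]

/-- Residual edges are the edges that lie in a triangle. -/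
theorem isResEdge_iff_triangle (hn : k + 2 ≤ n) {u w : StarVertex n k} :
    IsResEdge u w ↔ (starGraph n k).Adj u w ∧
      ∃ t, (starGraph n k).Adj u t ∧ (starGraph n k).Adj w t := by
  constructor
  · intro h
    refine ⟨starGraph_adj.2 (Or.inr h), ?_⟩
    have hcard : (insert (w.1 0) (Finset.univ.image u.1)).card < Fintype.card (Fin n) := by
      refine (Finset.card_insert_le _ _).trans_lt ?_
      have := Finset.card_image_le (s := Finset.univ) (f := u.1)
      simp only [Finset.card_univ, Fintype.card_fin] at this ⊢
      omega
    obtain ⟨x, hx⟩ := Finset.exists_mem_notMem_of_card_lt_card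
      (t := (Finset.univ : Finset (Fin n))) (by simpa using hcard)
    simp only [Finset.mem_insert, Finset.mem_image, Finset.mem_univ, true_and, not_or,
      not_exists] at hx
    obtain ⟨t, ht, rfl⟩ := exists_isResEdge hx.2
    exact ⟨t, starGraph_adj.2 (Or.inr ht), starGraph_adj.2 (Or.inr
      (h.trans_of_ne ht fun e => hx.1 (by rw [e])))⟩
  · rintro ⟨huw, t, hut, hwt⟩
    refine (starGraph_adj.1 huw).resolve_left fun h => ?_
    obtain ⟨i, hi, rfl⟩ := isStarEdge_iff.1 h
    by_cases hti : t.1 i = u.1 i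
    · have := eq_swapHead_of_adj hwt hi (by
        rw [hti, swapHead_apply_self]
        exact fun h => hi (u.2 h))
      rw [swapHead_swapHead] at this
      exact hut.ne this.symm
    · exact hwt.ne (eq_swapHead_of_adj hut hi hti).symm

section Automorphism

variable {σ : Perm (StarVertex n k)}

theorem isResEdge_map_iff (hn : k + 2 ≤ n) (hσ : σ ∈ graphAut (starGraph n k))
    {u w : StarVertex n k} : IsResEdge (σ u) (σ w) ↔ IsResEdge u w := by
  have hσ' : ∀ u w, (starGraph n k).Adj (σ u) (σ w) ↔ (starGraph n k).Adj u w := hσ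
  rw [isResEdge_iff_triangle hn, isResEdge_iff_triangle hn, hσ', ← σ.exists_congr_right]
  simp only [hσ']

theorem IsStarEdge.not_isResEdge {u w : StarVertex n k} (h : IsStarEdge u w) :
    ¬ IsResEdge u w := by
  obtain ⟨i, hi, rfl⟩ := isStarEdge_iff.1 h
  intro h
  have := (isResEdge_iff.1 h).2 i hi
  rw [swapHead_apply_self] at this
  exact hi (u.2 this)

theorem IsStarEdge.map (hn : k + 2 ≤ n) (hσ : σ ∈ graphAut (starGraph n k))
    {u w : StarVertex n k} (h : IsStarEdge u w) : IsStarEdge (σ u) (σ w) := by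
  have hadj : (starGraph n k).Adj (σ u) (σ w) := (hσ u w).2 (starGraph_adj.2 (Or.inl h))
  exact (starGraph_adj.1 hadj).resolve_right fun h' =>
    h.not_isResEdge ((isResEdge_map_iff hn hσ).1 h')

theorem position_eq_of_res_star_res {u v p q : StarVertex n k} {i j : Fin k} (hi : i ≠ 0)
    (hj : j ≠ 0) (hvu : IsResEdge v u) (h1 : IsResEdge (swapHead j u) p)
    (h2 : IsStarEdge p q) (h3 : IsResEdge q (swapHead i v)) : j = i := by
  by_contra hji
  obtain ⟨l, hl, rfl⟩ := isStarEdge_iff.1 h2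
  rw [isResEdge_iff] at hvu h1 h3
  have a1 := h1.2 i hi
  have a2 := h1.2 j hj
  have b1 := h3.2 i hi
  have b2 := h3.2 j hj
  have c1 := hvu.2 i hi
  have c2 := hvu.2 j hj
  have d1 := @v.2 0 i
  have d2 := @u.2 0 j
  simp only [swapHead_apply] at a1 a2 b1 b2
  grind

theorem apply_zero_eq_of_star_res_star {v s t p q : StarVertex n k} {i : Fin k} (hi : i ≠ 0)
    (hvt : IsResEdge (swapHead i v) t) (hvs : IsResEdge v s) (h1 : IsStarEdge t p)
    (h2 : IsResEdge p q) (h3 : IsStarEdge q s) : t.1 0 = s.1 0 := by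
  obtain ⟨l, hl, rfl⟩ := isStarEdge_iff.1 h1
  obtain ⟨m, hm, rfl⟩ := isStarEdge_iff.1 h3
  have e := hvs.apply_ne 0
  have f := hvt.apply_ne 0
  rw [isResEdge_iff] at hvt hvs h2
  have a1 := hvt.2 i hi
  have b1 := hvs.2 i hi
  have c1 := h2.2 i hi
  have d1 := @v.2 0 i
  simp only [swapHead_apply] at a1 b1 c1 e f ⊢
  grind

theorem position_eq_of_star_path {v : StarVertex n k} {i j m a b c : Fin k} (hi : i ≠ 0)
    (hj : j ≠ 0) (hm : m ≠ 0) (ha : a ≠ 0) (hb : b ≠ 0) (hc : c ≠ 0) (hij : j ≠ i)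
    (hmi : m ≠ i) (ham : a ≠ m)
    (h : swapHead j v = swapHead c (swapHead b (swapHead a (swapHead m (swapHead i v))))) :
    m = j := by
  have key : ∀ x, swap 0 j x = swap 0 i (swap 0 m (swap 0 a (swap 0 b (swap 0 c x)))) :=
    fun x => v.2 (congrFun (congrArg Subtype.val h) x)
  have k0 := key 0
  have k1 := key j
  have k2 := key m
  have k3 := key i
  have k4 := key c
  have k5 := key b
  simp only [swap_apply_def] at k0 k1 k2 k3 k4 k5
  grind

/-- `σ` fixes `v` and all neighbours of `v`. -/
def FixesBall (σ : Perm (StarVertex n k)) (v : StarVertex n k) : Prop :=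
  σ v = v ∧ ∀ u, (starGraph n k).Adj v u → σ u = u

theorem FixesBall.of_isResEdge (hn : k + 2 ≤ n) (hσ : σ ∈ graphAut (starGraph n k))
    {u v : StarVertex n k} (hv : FixesBall σ v) (hvu : IsResEdge v u) : FixesBall σ u := by
  have hu := hv.2 u (starGraph_adj.2 (Or.inr hvu))
  refine ⟨hu, fun t ht => ?_⟩
  rcases starGraph_adj.1 ht with ht | ht
  · have ht' := ht.map hn hσ
    rw [hu] at ht'
    obtain ⟨i, hi, rfl⟩ := isStarEdge_iff.1 ht
    obtain ⟨j, hj, hσt⟩ := isStarEdge_iff.1 ht'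
    have hw := hv.2 (swapHead i v) (starGraph_adj.2 (Or.inl (isStarEdge_iff.2 ⟨i, hi, rfl⟩)))
    obtain ⟨q, hwq, hq⟩ := exists_isResEdge (u := swapHead i v) (x := u.1 0)
      fun j => hvu.apply_ne (swap 0 i j)
    have hp : IsResEdge (swapHead i u) (swapHead i q) := by
      rw [isResEdge_iff] at *
      have a := hwq.2 i hi
      have b := hvu.2 i hi
      have d := @v.2 0 i
      simp only [swapHead_apply] at *
      grind
    have hpq : IsStarEdge (swapHead i q) q := isStarEdge_iff.2 ⟨i, hi, by simp⟩
    have h1 := (isResEdge_map_iff hn hσ).2 hp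
    have h2 := hpq.map hn hσ
    have h3 := (isResEdge_map_iff hn hσ).2 hwq.symm
    rw [hσt] at h1
    rw [hw] at h3
    rw [hσt, position_eq_of_res_star_res hi hj hvu h1 h2 h3]
  · by_cases htv : v = t
    · rw [← htv, hv.1]
    · exact hv.2 t (starGraph_adj.2 (Or.inr (hvu.symm.trans_of_ne ht htv)))

theorem FixesBall.of_isStarEdge (hn : k + 2 ≤ n) (hσ : σ ∈ graphAut (starGraph n k))
    {u v : StarVertex n k} (hv : FixesBall σ v) (hvu : IsStarEdge v u) : FixesBall σ u := by
  have hu := hv.2 u (starGraph_adj.2 (Or.inl hvu))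
  refine ⟨hu, fun t ht => ?_⟩
  obtain ⟨i, hi, rfl⟩ := isStarEdge_iff.1 hvu
  rcases starGraph_adj.1 ht with ht | ht
  · have ht' := ht.map hn hσ
    rw [hu] at ht'
    obtain ⟨j, hj, rfl⟩ := isStarEdge_iff.1 ht
    by_cases hji : j = i
    · rw [hji, swapHead_swapHead, hv.1]
    obtain ⟨m, hm, hσt⟩ := isStarEdge_iff.1 ht'
    have hw := hv.2 (swapHead j v) (starGraph_adj.2 (Or.inl (isStarEdge_iff.2 ⟨j, hj, rfl⟩)))
    set t := swapHead j (swapHead i v) with htdef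
    have hbraid : swapHead i (swapHead j (swapHead i t)) = swapHead j v :=
      StarVertex.ext fun x => by
        simp only [htdef, swapHead]
        simp only [swap_apply_def]
        grind
    have star (l : Fin k) (hl : l ≠ 0) (x : StarVertex n k) :
        ∃ a, a ≠ 0 ∧ σ (swapHead l x) = swapHead a (σ x) :=
      isStarEdge_iff.1 (IsStarEdge.map hn hσ (isStarEdge_iff.2 ⟨l, hl, rfl⟩))
    obtain ⟨a, ha, hσ1⟩ := star i hi t
    obtain ⟨b, hb, hσ2⟩ := star j hj (swapHead i t)
    obtain ⟨c, hc, hσ3⟩ := star i hi (swapHead j (swapHead i t))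
    have htv : t ≠ v := fun h => by
      refine hji (swapHead_left_injective (swapHead i v) (h.trans ?_))
      exact (swapHead_swapHead i v).symm
    have hmi : m ≠ i := by
      rintro rfl
      rw [swapHead_swapHead] at hσt
      exact htv (σ.injective (hσt.trans hv.1.symm))
    have ham : a ≠ m := by
      rintro rfl
      rw [hσt, swapHead_swapHead] at hσ1
      have h := σ.injective (hσ1.trans hu.symm)
      exact htv (by rw [← swapHead_swapHead i t, h, swapHead_swapHead])
    rw [hbraid, hσ2, hσ1, hσt, hw] at hσ3
    rw [hσt, position_eq_of_star_path hi hj hm ha hb hc hji hmi ham hσ3]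
  · have ht' := (isResEdge_map_iff hn hσ).2 ht
    rw [hu] at ht'
    obtain ⟨s, hvs, hs⟩ := exists_isResEdge (u := v) (x := t.1 0) fun j => by
      simpa [swapHead] using ht.apply_ne (swap 0 i j)
    have hpq : IsResEdge (swapHead i t) (swapHead i s) := by
      rw [isResEdge_iff] at *
      have a := ht.2 i hi
      have b := hvs.2 i hi
      have d := @v.2 0 i
      simp only [swapHead_apply] at *
      grind
    have h1 : IsStarEdge t (swapHead i t) := isStarEdge_iff.2 ⟨i, hi, rfl⟩
    have h3 : IsStarEdge (swapHead i s) s := isStarEdge_iff.2 ⟨i, hi, by simp⟩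
    have h3' := h3.map hn hσ
    rw [hv.2 s (starGraph_adj.2 (Or.inr hvs))] at h3'
    have := apply_zero_eq_of_star_res_star hi ht' hvs (h1.map hn hσ)
      ((isResEdge_map_iff hn hσ).2 hpq) h3'
    exact ht'.eq_of_apply_zero ht (this.trans hs)

end Automorphism

/-- The star graph is connected, as an induction principle. -/
theorem starGraph_induction {P : StarVertex n k → Prop} {v : StarVertex n k} (hv : P v)
    (hstar : ∀ u w, IsStarEdge u w → P u → P w) (hres : ∀ u w, IsResEdge u w → P u → P w)
    (t : StarVertex n k) : P t := by
  have hswap (i : Fin k) (u : StarVertex n k) (hu : P u) : P (swapHead i u) := by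
    by_cases hi : i = 0
    · have : swapHead i u = u := StarVertex.ext fun j => by simp [hi, swapHead]
      rwa [this]
    · exact hstar _ _ (isStarEdge_iff.2 ⟨i, hi, rfl⟩) hu
  induction hd : (Finset.univ.filter fun i => v.1 i ≠ t.1 i).card using Nat.strong_induction_on
    generalizing v with
  | _ d ih =>
  by_cases hvt : ∀ i, v.1 i = t.1 i
  · rwa [← StarVertex.ext hvt]
  push Not at hvt
  obtain ⟨i, hi⟩ := hvt
  obtain ⟨w, hw, hwi, hwj⟩ : ∃ w, P w ∧ w.1 i = t.1 i ∧
      ∀ j, v.1 j = t.1 j → w.1 j = t.1 j := by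
    by_cases hx : ∃ j, v.1 j = t.1 i
    · obtain ⟨j, hj⟩ := hx
      obtain ⟨w, hw, hw'⟩ : ∃ w, P w ∧ ∀ l, w.1 l = v.1 (swap i j l) := by
        by_cases hi0 : i = 0
        · exact ⟨swapHead j v, hswap _ _ hv, fun l => by simp [swapHead, hi0]⟩
        by_cases hj0 : j = 0
        · exact ⟨swapHead i v, hswap _ _ hv, fun l => by simp [swapHead, hj0, swap_comm]⟩
        refine ⟨_, hswap i _ (hswap j _ (hswap i _ hv)), fun l => ?_⟩
        simp only [swapHead_apply, swap_apply_def]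
        grind
      refine ⟨w, hw, by rw [hw', swap_apply_left, hj], fun l hl => ?_⟩
      have := @t.2 i l
      have := @t.2 j i
      rw [hw', swap_apply_def]
      grind
    · push Not at hx
      obtain ⟨s, hs, hs0⟩ := exists_isResEdge (u := swapHead i v) fun j => hx (swap 0 i j)
      refine ⟨swapHead i s, hswap _ _ (hres _ _ hs (hswap _ _ hv)), by simpa using hs0,
        fun l hl => ?_⟩
      have h := (isResEdge_iff.1 hs).2
      have h1 := h i
      have h2 := h l
      simp only [swapHead_apply] at *
      grind
  refine ih _ ?_ hw rfl
  rw [← hd]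
  refine Finset.card_lt_card (Finset.ssubset_iff_of_subset ?_ |>.2 ⟨i, by simpa using hi, ?_⟩)
  · intro j
    simp only [Finset.mem_filter, Finset.mem_univ, true_and]
    exact mt (hwj j)
  · simpa using hwi

theorem eq_one_of_fixesBall (hn : k + 2 ≤ n) {σ : Perm (StarVertex n k)}
    (hσ : σ ∈ graphAut (starGraph n k)) {v : StarVertex n k} (hv : FixesBall σ v) : σ = 1 :=
  Equiv.ext fun t => (starGraph_induction (P := FixesBall σ) hv
    (fun _ _ h hu => hu.of_isStarEdge hn hσ h) (fun _ _ h hu => hu.of_isResEdge hn hσ h) t).1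

theorem phi_swapHead {μ : Perm (Fin n)} {ν : Perm (Fin k)} (hν : ν 0 = 0) (i : Fin k)
    (u : StarVertex n k) : phi n k μ ν (swapHead i u) = swapHead (ν i) (phi n k μ ν u) := by
  refine StarVertex.ext fun j => ?_
  have h : ν⁻¹ (swap (ν 0) (ν i) j) = swap 0 i (ν⁻¹ j) := by
    rw [Perm.inv_eq_iff_eq, ← Perm.mul_apply, Equiv.mul_swap_eq_swap_mul, Perm.mul_apply]
    simp
  simp only [phi, swapHead]
  rw [← h, hν]

theorem isResEdge_phi {μ : Perm (Fin n)} {ν : Perm (Fin k)} (hν : ν 0 = 0)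
    {u w : StarVertex n k} (h : IsResEdge u w) : IsResEdge (phi n k μ ν u) (phi n k μ ν w) := by
  have hν' : ν⁻¹ 0 = 0 := by rw [Perm.inv_eq_iff_eq, hν]
  rw [isResEdge_iff] at *
  refine ⟨by simp only [phi, hν']; exact μ.injective.ne h.1, fun j hj => ?_⟩
  simp only [phi, EmbeddingLike.apply_eq_iff_eq]
  exact h.2 _ fun h => hj (by rw [Perm.inv_eq_iff_eq, hν] at h; exact h)

theorem adj_phi {μ : Perm (Fin n)} {ν : Perm (Fin k)} (hν : ν 0 = 0) {u w : StarVertex n k}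
    (h : (starGraph n k).Adj u w) : (starGraph n k).Adj (phi n k μ ν u) (phi n k μ ν w) := by
  rw [starGraph_adj] at *
  refine h.imp (fun h => ?_) (isResEdge_phi hν)
  obtain ⟨i, hi, rfl⟩ := isStarEdge_iff.1 h
  exact isStarEdge_iff.2 ⟨ν i, fun h => hi (ν.injective (h.trans hν.symm)), phi_swapHead hν i u⟩

theorem phiPerm_mem_graphAut {μ : Perm (Fin n)} {ν : Perm (Fin k)} (hν : ν 0 = 0) :
    phiPerm n k μ ν ∈ graphAut (starGraph n k) := by
  have hν' : ν⁻¹ 0 = 0 := by rw [Perm.inv_eq_iff_eq, hν]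
  intro u w
  refine ⟨fun h => ?_, adj_phi hν⟩
  have h' := adj_phi (μ := μ⁻¹) hν' h
  have e (x) : phi n k μ⁻¹ ν⁻¹ (phiPerm n k μ ν x) = x := (phiPerm n k μ ν).symm_apply_apply x
  rwa [e, e] at h'

/-- An enumeration of the star-adjacent neighbours of `v` is an enumeration of the nonzero
positions. -/
theorem exists_equiv_of_star_enumeration {ι : Type*} {v : StarVertex n k}
    {W : ι → StarVertex n k} (hW : Function.Injective W) (hW1 : ∀ j, IsStarEdge v (W j))
    (hW2 : ∀ x, IsStarEdge v x → ∃ j, W j = x) :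
    ∃ I : ι ≃ {i : Fin k // i ≠ 0}, ∀ j, W j = swapHead (I j).1 v := by
  choose I hI0 hI using fun j => isStarEdge_iff.1 (hW1 j)
  refine ⟨Equiv.ofBijective (fun j => ⟨I j, hI0 j⟩) ⟨fun a b hab => hW ?_, fun i => ?_⟩, hI⟩
  · rw [hI a, hI b, show I a = I b from congrArg Subtype.val hab]
  · obtain ⟨j, hj⟩ := hW2 (swapHead i.1 v) (isStarEdge_iff.2 ⟨i.1, i.2, rfl⟩)
    exact ⟨j, Subtype.ext (swapHead_left_injective v ((hI j).symm.trans hj))⟩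

/-- The entries of `v` together with the first entries of its residual-adjacent neighbours
enumerate all symbols. -/
theorem bijective_elim_of_res_enumeration {ι : Type*} {v : StarVertex n k}
    {U : ι → StarVertex n k} (hU : Function.Injective U) (hU1 : ∀ i, IsResEdge v (U i))
    (hU2 : ∀ x, IsResEdge v x → ∃ i, U i = x) :
    Function.Bijective (Sum.elim v.1 fun i => (U i).1 0) := by
  refine ⟨v.2.sumElim (fun a b h => hU ((hU1 a).eq_of_apply_zero (hU1 b) h))
    fun j i => (hU1 i).apply_ne j, fun x => ?_⟩
  by_cases hx : ∃ j, v.1 j = x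
  · exact ⟨Sum.inl hx.choose, hx.choose_spec⟩
  · push Not at hx
    obtain ⟨t, ht, rfl⟩ := exists_isResEdge hx
    obtain ⟨i, rfl⟩ := hU2 t ht
    exact ⟨Sum.inr i, rfl⟩

end StarGraph

/-- Let `v`, `v'` be vertices of `S_{n,k}`, let `U`, `U'` enumerate the residual-adjacent
neighbors of `v`, `v'` respectively, and let `W`, `W'` enumerate the star-adjacent
neighbors of `v`, `v'` respectively. Then there is a unique automorphism `f` of `S_{n,k}`
with `f v = v'`, `f (U i) = U' i` for all `i`, and `f (W j) = W' j` for all `j`. -/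
theorem unique_aut_matching_neighbors (n k : ℕ) (hk : 2 ≤ k) (hn : k + 2 ≤ n)
    (v v' : StarVertex n k)
    (U U' : Fin (n - k) → StarVertex n k) (W W' : Fin (k - 1) → StarVertex n k)
    (hU : Function.Injective U) (hU1 : ∀ i, IsResEdge v (U i))
    (hU2 : ∀ x, IsResEdge v x → ∃ i, U i = x)
    (hU' : Function.Injective U') (hU'1 : ∀ i, IsResEdge v' (U' i))
    (hU'2 : ∀ x, IsResEdge v' x → ∃ i, U' i = x)
    (hW : Function.Injective W) (hW1 : ∀ j, IsStarEdge v (W j))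
    (hW2 : ∀ x, IsStarEdge v x → ∃ j, W j = x)
    (hW' : Function.Injective W') (hW'1 : ∀ j, IsStarEdge v' (W' j))
    (hW'2 : ∀ x, IsStarEdge v' x → ∃ j, W' j = x) :
    ∃! σ : ↥(graphAut (starGraph n k)),
      (σ.1 : Equiv.Perm (StarVertex n k)) v = v' ∧
      (∀ i, (σ.1 : Equiv.Perm (StarVertex n k)) (U i) = U' i) ∧
      ∀ j, (σ.1 : Equiv.Perm (StarVertex n k)) (W j) = W' j := by
  have : NeZero k := ⟨by omega⟩
  obtain ⟨I, hI⟩ := exists_equiv_of_star_enumeration hW hW1 hW2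
  obtain ⟨I', hI'⟩ := exists_equiv_of_star_enumeration hW' hW'1 hW'2
  let ν : Perm (Fin k) := Perm.ofSubtype (I.symm.trans I' : Perm {i : Fin k // i ≠ 0})
  have hν : ν 0 = 0 := Perm.ofSubtype_apply_of_not_mem _ (by simp)
  have hνI (j) : ν (I j).1 = (I' j).1 := by simp [ν]
  let e := Equiv.ofBijective _ (bijective_elim_of_res_enumeration hU hU1 hU2)
  let e' := Equiv.ofBijective _ (bijective_elim_of_res_enumeration hU' hU'1 hU'2)
  let μ : Perm (Fin n) := e.symm.trans ((Equiv.sumCongr ν (Equiv.refl _)).trans e')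
  have hμv (j) : μ (v.1 j) = v'.1 (ν j) := by
    have h : e.symm (v.1 j) = Sum.inl j := (Equiv.symm_apply_eq e).2 rfl
    simp [μ, h, e']
  have hμU (i) : μ ((U i).1 0) = (U' i).1 0 := by
    have h : e.symm ((U i).1 0) = Sum.inr i := (Equiv.symm_apply_eq e).2 rfl
    simp [μ, h, e']
  have hv : phi n k μ ν v = v' := StarVertex.ext fun j => by simp [phi, hμv]
  refine existsUnique_of_exists_of_unique
    ⟨⟨phiPerm n k μ ν, phiPerm_mem_graphAut hν⟩, hv, fun i => ?_, fun j => ?_⟩ ?_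
  · have h := isResEdge_phi (μ := μ) hν (hU1 i)
    rw [hv] at h
    refine h.eq_of_apply_zero (hU'1 i) ?_
    have hν' : ν⁻¹ 0 = 0 := by rw [Perm.inv_eq_iff_eq, hν]
    simp only [phi, hν', hμU]
  · change phi n k μ ν (W j) = W' j
    rw [hI, phi_swapHead hν, hv, hνI, hI']
  · rintro σ τ ⟨hσv, hσU, hσW⟩ ⟨hτv, hτU, hτW⟩
    have hfix : FixesBall (τ⁻¹ * σ).1 v := by
      refine ⟨Perm.inv_eq_iff_eq.2 (hσv.trans hτv.symm), fun u hu => ?_⟩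
      rcases starGraph_adj.1 hu with hu | hu
      · obtain ⟨j, rfl⟩ := hW2 u hu
        exact Perm.inv_eq_iff_eq.2 ((hσW j).trans (hτW j).symm)
      · obtain ⟨i, rfl⟩ := hU2 u hu
        exact Perm.inv_eq_iff_eq.2 ((hσU i).trans (hτU i).symm)
    have h : τ⁻¹ * σ = 1 := Subtype.ext (eq_one_of_fixesBall hn (τ⁻¹ * σ).2 hfix)
    exact (inv_mul_eq_one.1 h).symm
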